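/- Let M be a model of ZFC(∈₁) ∪ ZFC(∈₂). Then for every element x of M there exists an element y of M with φ(x,y), and for every element y of M there exists an element x of M with φ(x,y). That is, the class relation defined by φ in M is total and surjective. -/

import Mathlib

universe u

/-! ## Syntax of the first-order language `L = {∈₁, ∈₂}`

Formulas of the first-order language with two binary relation symbols `∈₁`
and `∈₂` (and equality), with variables indexed by `ℕ`. -/
inductive Fml : Type
  | mem1 : ℕ → ℕ → Fml
  | mem2 : ℕ → ℕ → Fml
  | eq   : ℕ → ℕ → Fml
  | fal  : Fml
  | imp  : Fml → Fml → Fml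
  | all  : ℕ → Fml → Fml

/-- Satisfaction of an `L`-formula in a structure `(M, e₁, e₂)` under a
valuation `v : ℕ → M` of the variables. -/
def Fml.Sat {M : Type u} (e₁ e₂ : M → M → Prop) : Fml → (ℕ → M) → Prop
  | .mem1 i j, v => e₁ (v i) (v j)
  | .mem2 i j, v => e₂ (v i) (v j)
  | .eq i j,   v => v i = v j
  | .fal,      _ => False
  | .imp φ ψ,  v => φ.Sat e₁ e₂ v → ψ.Sat e₁ e₂ v
  | .all n φ,  v => ∀ a : M, φ.Sat e₁ e₂ (Function.update v n a)

/-! ## The ZFC axioms, with membership relation `e`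

The Separation and Replacement schemas range over all `L`-formulas, i.e. the
formulas may mention both `∈₁` and `∈₂`; the remaining axioms only mention
the membership relation `e` itself. -/

def Extensionality {M : Type u} (e : M → M → Prop) : Prop :=
  ∀ x y : M, (∀ t, e t x ↔ e t y) → x = y

def Foundation {M : Type u} (e : M → M → Prop) : Prop :=
  ∀ x : M, (∃ t, e t x) → ∃ t, e t x ∧ ∀ s, e s t → ¬ e s x

def Pairing {M : Type u} (e : M → M → Prop) : Prop :=
  ∀ x y : M, ∃ p : M, ∀ t, e t p ↔ (t = x ∨ t = y)

def UnionAx {M : Type u} (e : M → M → Prop) : Prop :=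
  ∀ x : M, ∃ u : M, ∀ t, e t u ↔ ∃ s, e s x ∧ e t s

def PowerSetAx {M : Type u} (e : M → M → Prop) : Prop :=
  ∀ x : M, ∃ p : M, ∀ t, e t p ↔ ∀ s, e s t → e s x

def InfinityAx {M : Type u} (e : M → M → Prop) : Prop :=
  ∃ w : M, (∃ z, e z w ∧ ∀ t, ¬ e t z) ∧
    ∀ t, e t w → ∃ s, e s w ∧ ∀ u, e u s ↔ (e u t ∨ u = t)

/-- The axiom of choice: every set of nonempty pairwise disjoint sets has a
choice set. -/
def ChoiceAx {M : Type u} (e : M → M → Prop) : Prop :=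
  ∀ x : M, (∀ t, e t x → ∃ s, e s t) →
    (∀ t t', e t x → e t' x → t ≠ t' → ¬ ∃ s, e s t ∧ e s t') →
    ∃ c : M, ∀ t, e t x → ∃! s, e s t ∧ e s c

/-- The Separation Schema for the membership relation `e`, where the
formulas range over all `L`-formulas (interpreted with `∈₁ := e₁`,
`∈₂ := e₂`) and may use parameters (supplied by the valuation `v`);
variable `0` is the variable being separated on. -/
def SeparationSchema {M : Type u} (e e₁ e₂ : M → M → Prop) : Prop :=
  ∀ (φ : Fml) (v : ℕ → M) (a : M), ∃ b : M,
    ∀ t : M, e t b ↔ (e t a ∧ φ.Sat e₁ e₂ (Function.update v 0 t))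

/-- The Replacement Schema for the membership relation `e`, where the
formulas range over all `L`-formulas (interpreted with `∈₁ := e₁`,
`∈₂ := e₂`) and may use parameters; variables `0` and `1` are the
argument/value variables of the class function defined by `φ`. -/
def ReplacementSchema {M : Type u} (e e₁ e₂ : M → M → Prop) : Prop :=
  ∀ (φ : Fml) (v : ℕ → M) (a : M),
    (∀ t, e t a → ∃! s, φ.Sat e₁ e₂ (Function.update (Function.update v 0 t) 1 s)) →
    ∃ b : M, ∀ t, e t a → ∀ s,
      φ.Sat e₁ e₂ (Function.update (Function.update v 0 t) 1 s) → e s b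

/-- A model `(M, ∈₁, ∈₂)` of `ZFC(∈₁) ∪ ZFC(∈₂)`: the first-order ZFC axioms
hold for the membership relation `∈₁`, with the Separation and Replacement
schemas ranging over all formulas of the language `L = {∈₁, ∈₂}`, and
likewise for the membership relation `∈₂`. -/
structure ZFC2Model (M : Type u) : Type u where
  mem1 : M → M → Prop
  mem2 : M → M → Prop
  ext1 : Extensionality mem1
  found1 : Foundation mem1
  pair1 : Pairing mem1
  union1 : UnionAx mem1
  power1 : PowerSetAx mem1
  infinity1 : InfinityAx mem1
  choice1 : ChoiceAx mem1
  sep1 : SeparationSchema mem1 mem1 mem2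
  repl1 : ReplacementSchema mem1 mem1 mem2
  ext2 : Extensionality mem2
  found2 : Foundation mem2
  pair2 : Pairing mem2
  union2 : UnionAx mem2
  power2 : PowerSetAx mem2
  infinity2 : InfinityAx mem2
  choice2 : ChoiceAx mem2
  sep2 : SeparationSchema mem2 mem1 mem2
  repl2 : ReplacementSchema mem2 mem1 mem2

/-! ## Defined notions, relative to a membership relation `e` -/

/-- `u` is a transitive set in the sense of `e`. -/
def IsTransSet {M : Type u} (e : M → M → Prop) (x : M) : Prop :=
  ∀ t, e t x → ∀ w, e w t → e w x

/-- `u` is the `e`-transitive closure `TC(x)` of `x`: the least transitive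
set containing all `e`-elements of `x`. -/
def IsTC {M : Type u} (e : M → M → Prop) (x u : M) : Prop :=
  IsTransSet e u ∧ (∀ v, e v x → e v u) ∧
    ∀ v, IsTransSet e v → (∀ w, e w x → e w v) → ∀ w, e w u → e w v

/-- `s` is the singleton `{x}` in the sense of `e`. -/
def IsSingleton {M : Type u} (e : M → M → Prop) (x s : M) : Prop :=
  ∀ t, e t s ↔ t = x

/-- `p` is the (Kuratowski) ordered pair `⟨a, b⟩ = {{a}, {a, b}}` in the
sense of `e`. -/
def IsOPair {M : Type u} (e : M → M → Prop) (a b p : M) : Prop :=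
  ∃ sa pab : M, IsSingleton e a sa ∧ (∀ t, e t pab ↔ (t = a ∨ t = b)) ∧
    (∀ t, e t p ↔ (t = sa ∨ t = pab))

/-- `f(a) = b` in the sense of `e`: the ordered pair `⟨a, b⟩` is an
`e`-element of `f`. -/
def FunVal {M : Type u} (e : M → M → Prop) (f a b : M) : Prop :=
  ∃ p, e p f ∧ IsOPair e a b p

/-- In the sense of `e`, the set `f` is a function with domain `d`. -/
def IsFuncOn {M : Type u} (e : M → M → Prop) (f d : M) : Prop :=
  (∀ p, e p f → ∃ a b, e a d ∧ IsOPair e a b p) ∧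
  (∀ a, e a d → ∃ b, FunVal e f a b) ∧
  (∀ a b b', FunVal e f a b → FunVal e f a b' → b = b')

/-- `On(α)` in the sense of `e`: `α` is an ordinal, i.e. a transitive set of
transitive sets. -/
def IsOrd {M : Type u} (e : M → M → Prop) (α : M) : Prop :=
  IsTransSet e α ∧ ∀ t, e t α → IsTransSet e t

/-- `v = V_α`, the `α`-th level of the cumulative hierarchy in the sense of
`e`: there is a function `g` (in the sense of `e`) with domain `α ∪ {α}`
such that `g(β) = { t : t ⊆ g(γ) for some γ ∈ β }` for every `β ∈ α ∪ {α}`,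
and `v = g(α)`. -/
def IsVLevel {M : Type u} (e : M → M → Prop) (α v : M) : Prop :=
  ∃ g s : M, (∀ t, e t s ↔ (e t α ∨ t = α)) ∧ IsFuncOn e g s ∧
    (∀ β, e β s → ∀ gβ, FunVal e g β gβ → ∀ t,
      (e t gβ ↔ ∃ γ, e γ β ∧ ∃ gγ, FunVal e g γ gγ ∧ ∀ w, e w t → e w gγ)) ∧
    FunVal e g α v

/-! ## The formulas `ψ(x, y, f)` and `φ(x, y)` -/

/-- The formula `ψ(x, y, f)` of Väänänen's paper, asserting that (i) in the
sense of `∈₁`, `f` is a function with domain `TC₁({x})`; (ii) `f` maps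
`TC₁(x)` into `TC₂(y)`; (iii) `f` maps `TC₁(x)` onto `TC₂(y)`; (iv) for all
`t ∈₁ TC₁(x)` and `w ∈₁ TC₁({x})`, `t ∈₁ w ↔ f(t) ∈₂ f(w)`; and (v)
`f(x) = y`.  (Here `f` is applied in the sense of `∈₁`.) -/
def Psi {M : Type u} (e₁ e₂ : M → M → Prop) (x y f : M) : Prop :=
  ∃ sx tcsx tcx tcy : M,
    IsSingleton e₁ x sx ∧ IsTC e₁ sx tcsx ∧ IsTC e₁ x tcx ∧ IsTC e₂ y tcy ∧
    -- (i)
    IsFuncOn e₁ f tcsx ∧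
    -- (ii)
    (∀ t, e₁ t tcx → ∀ ft, FunVal e₁ f t ft → e₂ ft tcy) ∧
    -- (iii)
    (∀ t, e₂ t tcy → ∃ w, e₁ w tcx ∧ FunVal e₁ f w t) ∧
    -- (iv)
    (∀ t, e₁ t tcx → ∀ w, e₁ w tcsx → ∀ ft fw,
      FunVal e₁ f t ft → FunVal e₁ f w fw → (e₁ t w ↔ e₂ ft fw)) ∧
    -- (v)
    FunVal e₁ f x y

/-- The formula `φ(x, y) := ∃f ψ(x, y, f)`. -/
def Phi {M : Type u} (e₁ e₂ : M → M → Prop) (x y : M) : Prop :=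
  ∃ f, Psi e₁ e₂ x y f

section Definability

variable {M : Type u}

/-- Renaming of variables. -/
def Fml.ren (σ : ℕ → ℕ) : Fml → Fml
  | .mem1 i j => .mem1 (σ i) (σ j)
  | .mem2 i j => .mem2 (σ i) (σ j)
  | .eq i j => .eq (σ i) (σ j)
  | .fal => .fal
  | .imp φ ψ => .imp (φ.ren σ) (ψ.ren σ)
  | .all n φ => .all (σ n) (φ.ren σ)

/-- A bound for all variables. -/
def Fml.bd : Fml → ℕ
  | .mem1 i j => i + j + 1
  | .mem2 i j => i + j + 1
  | .eq i j => i + j + 1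
  | .fal => 0
  | .imp φ ψ => φ.bd + ψ.bd
  | .all n φ => n + φ.bd + 1

theorem Fml.sat_ren (e₁ e₂ : M → M → Prop) (σ : ℕ → ℕ) (hσ : Function.Injective σ) (φ : Fml) :
    ∀ v : ℕ → M, (φ.ren σ).Sat e₁ e₂ v ↔ φ.Sat e₁ e₂ (fun n => v (σ n)) := by
  induction φ with
  | mem1 i j => intro v; exact Iff.rfl
  | mem2 i j => intro v; exact Iff.rfl
  | eq i j => intro v; exact Iff.rfl
  | fal => intro v; exact Iff.rfl
  | imp φ ψ h1 h2 => intro v; exact imp_congr (h1 v) (h2 v)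
  | all n φ ih =>
    intro v
    refine forall_congr' fun a => ?_
    rw [ih]
    have : (fun k => Function.update v (σ n) a (σ k))
        = Function.update (fun k => v (σ k)) n a := by
      funext k
      by_cases h : k = n
      · subst h; simp
      · rw [Function.update_of_ne h, Function.update_of_ne (fun h' => h (hσ h'))]
    rw [this]

theorem Fml.sat_congr (e₁ e₂ : M → M → Prop) (φ : Fml) :
    ∀ v w : ℕ → M, (∀ k < φ.bd, v k = w k) → (φ.Sat e₁ e₂ v ↔ φ.Sat e₁ e₂ w) := by
  induction φ with
  | mem1 i j =>
    intro v w h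
    simp only [Fml.Sat]
    rw [h i (by simp only [Fml.bd]; omega), h j (by simp only [Fml.bd]; omega)]
  | mem2 i j =>
    intro v w h
    simp only [Fml.Sat]
    rw [h i (by simp only [Fml.bd]; omega), h j (by simp only [Fml.bd]; omega)]
  | eq i j =>
    intro v w h
    simp only [Fml.Sat]
    rw [h i (by simp only [Fml.bd]; omega), h j (by simp only [Fml.bd]; omega)]
  | fal => intro v w h; exact Iff.rfl
  | imp φ ψ h1 h2 =>
    intro v w h
    exact imp_congr (h1 v w fun k hk => h k (by simp only [Fml.bd]; omega))
      (h2 v w fun k hk => h k (by simp only [Fml.bd]; omega))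
  | all n φ ih =>
    intro v w h
    refine forall_congr' fun a => ih _ _ fun k hk => ?_
    by_cases h' : k = n
    · subst h'; simp
    · rw [Function.update_of_ne h', Function.update_of_ne h']
      exact h k (by simp only [Fml.bd]; omega)

/-- A property of environments is definable by an `L`-formula. -/
def Dfb (e₁ e₂ : M → M → Prop) (P : (ℕ → M) → Prop) : Prop :=
  ∃ φ : Fml, ∀ v, φ.Sat e₁ e₂ v ↔ P v

variable {e₁ e₂ : M → M → Prop}

theorem Dfb.m1 (i j : ℕ) : Dfb e₁ e₂ (fun v => e₁ (v i) (v j)) := ⟨.mem1 i j, fun _ => Iff.rfl⟩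
theorem Dfb.m2 (i j : ℕ) : Dfb e₁ e₂ (fun v => e₂ (v i) (v j)) := ⟨.mem2 i j, fun _ => Iff.rfl⟩
theorem Dfb.eq (i j : ℕ) : Dfb e₁ e₂ (fun v => v i = v j) := ⟨.eq i j, fun _ => Iff.rfl⟩
theorem Dfb.fal : Dfb e₁ e₂ (fun _ => False) := ⟨.fal, fun _ => Iff.rfl⟩
theorem Dfb.imp {P Q : (ℕ → M) → Prop} (hP : Dfb e₁ e₂ P) (hQ : Dfb e₁ e₂ Q) :
    Dfb e₁ e₂ (fun v => P v → Q v) := by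
  obtain ⟨φ, hφ⟩ := hP
  obtain ⟨ψ, hψ⟩ := hQ
  exact ⟨.imp φ ψ, fun v => imp_congr (hφ v) (hψ v)⟩
theorem Dfb.not {P : (ℕ → M) → Prop} (hP : Dfb e₁ e₂ P) : Dfb e₁ e₂ (fun v => ¬ P v) :=
  hP.imp Dfb.fal
theorem Dfb.congr {P Q : (ℕ → M) → Prop} (hP : Dfb e₁ e₂ P) (h : ∀ v, P v ↔ Q v) :
    Dfb e₁ e₂ Q := by
  obtain ⟨φ, hφ⟩ := hP
  exact ⟨φ, fun v => (hφ v).trans (h v)⟩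
theorem Dfb.and {P Q : (ℕ → M) → Prop} (hP : Dfb e₁ e₂ P) (hQ : Dfb e₁ e₂ Q) :
    Dfb e₁ e₂ (fun v => P v ∧ Q v) :=
  (hP.imp hQ.not).not.congr fun v => by tauto
theorem Dfb.or {P Q : (ℕ → M) → Prop} (hP : Dfb e₁ e₂ P) (hQ : Dfb e₁ e₂ Q) :
    Dfb e₁ e₂ (fun v => P v ∨ Q v) :=
  (hP.not.imp hQ).congr fun v => by tauto
theorem Dfb.iff {P Q : (ℕ → M) → Prop} (hP : Dfb e₁ e₂ P) (hQ : Dfb e₁ e₂ Q) :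
    Dfb e₁ e₂ (fun v => P v ↔ Q v) :=
  ((hP.imp hQ).and (hQ.imp hP)).congr fun v => by tauto

theorem Dfb.all {Q : (ℕ → M) → M → Prop}
    (h : Dfb e₁ e₂ (fun v => Q (fun n => v (n + 1)) (v 0))) :
    Dfb e₁ e₂ (fun v => ∀ a, Q v a) := by
  obtain ⟨φ, hφ⟩ := h
  obtain ⟨N, hN⟩ : ∃ N, N = φ.bd := ⟨_, rfl⟩
  let σ : ℕ → ℕ := fun k => if k = 0 then N else if k ≤ N then k - 1 else k
  have hσ : Function.Injective σ := by
    intro a b hab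
    simp only [σ] at hab
    split_ifs at hab <;> omega
  refine ⟨.all N (φ.ren σ), fun v => forall_congr' fun a => ?_⟩
  rw [Fml.sat_ren _ _ _ hσ]
  let w : ℕ → M := fun k => Nat.casesOn k a v
  rw [Fml.sat_congr e₁ e₂ φ _ w]
  · exact hφ w
  · intro k hk
    have hk : k < N := hN ▸ hk
    cases k with
    | zero => simp [σ, w]
    | succ k =>
      have h1 : σ (k + 1) = k := by
        change (if k + 1 = 0 then N else if k + 1 ≤ N then k + 1 - 1 else k + 1) = k
        rw [if_neg (by omega), if_pos (by omega)]
        omega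
      simp only [h1, w]
      rw [Function.update_of_ne (by omega)]

theorem Dfb.ex {Q : (ℕ → M) → M → Prop}
    (h : Dfb e₁ e₂ (fun v => Q (fun n => v (n + 1)) (v 0))) :
    Dfb e₁ e₂ (fun v => ∃ a, Q v a) :=
  (Dfb.all (Q := fun v a => ¬ Q v a) h.not).not.congr fun v => by simp

end Definability

/-- Axioms for one membership relation, with schemas for `L`-formulas. -/
structure ZFD {M : Type u} (e₁ e₂ e : M → M → Prop) : Prop where
  ext : Extensionality e
  found : Foundation e
  pair : Pairing e
  union : UnionAx e
  power : PowerSetAx e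
  inf : InfinityAx e
  sep0 : SeparationSchema e e₁ e₂
  repl0 : ReplacementSchema e e₁ e₂
  dm : ∀ i j : ℕ, Dfb e₁ e₂ (fun v => e (v i) (v j))

namespace ZFD

variable {M : Type u} {e₁ e₂ e : M → M → Prop}

theorem sep (S : ZFD e₁ e₂ e) (Q : M → M → M → M → M → Prop)
    (hQ : Dfb e₁ e₂ (fun v => Q (v 0) (v 1) (v 2) (v 3) (v 4))) (a p q r s : M) :
    ∃ b, ∀ t, e t b ↔ e t a ∧ Q t p q r s := by
  obtain ⟨φ, hφ⟩ := hQ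
  obtain ⟨b, hb⟩ := S.sep0 φ
    (fun n => if n = 1 then p else if n = 2 then q else if n = 3 then r else s) a
  refine ⟨b, fun t => ?_⟩
  rw [hb, hφ]
  simp [Function.update]

theorem repl (S : ZFD e₁ e₂ e) (Q : M → M → M → Prop)
    (hQ : Dfb e₁ e₂ (fun v => Q (v 0) (v 1) (v 2))) (a p : M)
    (h : ∀ t, e t a → ∃! s, Q t s p) : ∃ b, ∀ t, e t a → ∀ s, Q t s p → e s b := by
  obtain ⟨φ, hφ⟩ := hQ
  obtain ⟨b, hb⟩ := S.repl0 φ (fun n => p) a (by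
    intro t ht
    simpa [hφ, Function.update] using h t ht)
  refine ⟨b, fun t ht s hs => hb t ht s ?_⟩
  simpa [hφ, Function.update] using hs

/-- Partial class functions have bounded image on sets. -/
theorem coll (S : ZFD e₁ e₂ e) (Q : M → M → M → Prop)
    (hQ : ∀ i j k, Dfb e₁ e₂ (fun v => Q (v i) (v j) (v k))) (a p : M)
    (h : ∀ t, e t a → ∀ s s', Q t s p → Q t s' p → s = s') :
    ∃ b, ∀ t, e t a → ∀ s, Q t s p → e s b := by
  obtain ⟨a', ha'⟩ := S.sep (fun t p _ _ _ => ∃ s, Q t s p) (Dfb.ex (hQ _ _ _)) a p p p p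
  obtain ⟨b, hb⟩ := S.repl Q (hQ _ _ _) a' p (by
    intro t ht
    obtain ⟨h1, s, hs⟩ := (ha' t).1 ht
    exact ⟨s, hs, fun s' hs' => h t h1 _ _ hs' hs⟩)
  exact ⟨b, fun t ht s hs => hb t ((ha' t).2 ⟨ht, s, hs⟩) s hs⟩

theorem not_mem_self (S : ZFD e₁ e₂ e) (a : M) : ¬ e a a := by
  intro h
  obtain ⟨p, hp⟩ := S.pair a a
  obtain ⟨t, ht, h'⟩ := S.found p ⟨a, by simp [hp]⟩
  have : t = a := by simpa [hp] using ht
  subst this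
  exact h' t h ht

theorem not_mem_symm (S : ZFD e₁ e₂ e) (a b : M) : e a b → ¬ e b a := by
  intro h h2
  obtain ⟨p, hp⟩ := S.pair a b
  obtain ⟨t, ht, h'⟩ := S.found p ⟨a, by simp [hp]⟩
  rcases (hp t).1 ht with rfl | rfl
  · exact h' b h2 (by simp [hp])
  · exact h' a h (by simp [hp])

theorem single (S : ZFD e₁ e₂ e) (a : M) : ∃ s, IsSingleton e a s := by
  obtain ⟨p, hp⟩ := S.pair a a
  exact ⟨p, fun t => by simp [hp]⟩

theorem union2 (S : ZFD e₁ e₂ e) (a b : M) : ∃ s, ∀ t, e t s ↔ e t a ∨ e t b := by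
  obtain ⟨p, hp⟩ := S.pair a b
  obtain ⟨u, hu⟩ := S.union p
  refine ⟨u, fun t => ?_⟩
  simp [hu, hp]

theorem opair (S : ZFD e₁ e₂ e) (a b : M) : ∃ p, IsOPair e a b p := by
  obtain ⟨sa, hsa⟩ := S.single a
  obtain ⟨pab, hpab⟩ := S.pair a b
  obtain ⟨p, hp⟩ := S.pair sa pab
  exact ⟨p, sa, pab, hsa, hpab, hp⟩

theorem opair_inj {a b c d p : M} (h : IsOPair e a b p) (h' : IsOPair e c d p) :
    a = c ∧ b = d := by
  obtain ⟨s, q, hs, hq, hp⟩ := h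
  obtain ⟨s', q', hs', hq', hp'⟩ := h'
  have ac : a = c := by
    have h1 : s = s' ∨ s = q' := (hp' s).1 ((hp s).2 (Or.inl rfl))
    rcases h1 with h1 | h1
    · exact (hs' a).1 (h1 ▸ (hs a).2 rfl)
    · have : e c s := h1 ▸ (hq' c).2 (Or.inl rfl)
      exact ((hs c).1 this).symm
  subst ac
  refine ⟨rfl, ?_⟩
  have hb : b = a ∨ b = d := by
    have h1 : q = s' ∨ q = q' := (hp' q).1 ((hp q).2 (Or.inr rfl))
    have h2 : e b q := (hq b).2 (Or.inr rfl)
    rcases h1 with h1 | h1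
    · rw [h1] at h2; exact Or.inl ((hs' b).1 h2)
    · rw [h1] at h2; exact (hq' b).1 h2
  have hd : d = a ∨ d = b := by
    have h1 : q' = s ∨ q' = q := (hp q').1 ((hp' q').2 (Or.inr rfl))
    have h2 : e d q' := (hq' d).2 (Or.inr rfl)
    rcases h1 with h1 | h1
    · rw [h1] at h2; exact Or.inl ((hs d).1 h2)
    · rw [h1] at h2; exact (hq d).1 h2
  grind

theorem opair_unique (S : ZFD e₁ e₂ e) {a b p q : M} (h : IsOPair e a b p)
    (h' : IsOPair e a b q) : p = q := by
  obtain ⟨s, r, hs, hr, hp⟩ := h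
  obtain ⟨s', r', hs', hr', hp'⟩ := h'
  have h1 : s = s' := S.ext _ _ fun t => (hs t).trans (hs' t).symm
  have h2 : r = r' := S.ext _ _ fun t => (hr t).trans (hr' t).symm
  subst h1 h2
  exact S.ext _ _ fun t => (hp t).trans (hp' t).symm

theorem d_opair (S : ZFD e₁ e₂ e) (i j k : ℕ) :
    Dfb e₁ e₂ (fun v => IsOPair e (v i) (v j) (v k)) := by
  unfold IsOPair IsSingleton
  repeat' first
    | with_reducible exact S.dm _ _ | with_reducible exact Dfb.eq _ _ | with_reducible apply Dfb.all
    | with_reducible apply Dfb.ex | with_reducible apply Dfb.and | with_reducible apply Dfb.or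
    | with_reducible apply Dfb.iff

theorem d_funVal (S : ZFD e₁ e₂ e) (i j k : ℕ) :
    Dfb e₁ e₂ (fun v => FunVal e (v i) (v j) (v k)) :=
  Dfb.ex ((S.dm _ _).and (S.d_opair _ _ _))

/-- adding a pair to a relation. -/
theorem addPair (S : ZFD e₁ e₂ e) (g a b : M) :
    ∃ g', ∀ c d, FunVal e g' c d ↔ FunVal e g c d ∨ (c = a ∧ d = b) := by
  obtain ⟨p, hp⟩ := S.opair a b
  obtain ⟨s, hs⟩ := S.single p
  obtain ⟨g', hg'⟩ := S.union2 g s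
  refine ⟨g', fun c d => ⟨?_, ?_⟩⟩
  · rintro ⟨q, hq, hcd⟩
    rcases (hg' q).1 hq with h | h
    · exact Or.inl ⟨q, h, hcd⟩
    · have := (hs q).1 h
      subst this
      exact Or.inr (opair_inj hcd hp)
  · rintro (⟨q, hq, hcd⟩ | ⟨rfl, rfl⟩)
    · exact ⟨q, (hg' q).2 (Or.inl hq), hcd⟩
    · exact ⟨p, (hg' p).2 (Or.inr ((hs p).2 rfl)), hp⟩

theorem prod (S : ZFD e₁ e₂ e) (A B : M) :
    ∃ P, ∀ c d p, e c A → e d B → IsOPair e c d p → e p P := by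
  obtain ⟨U, hU⟩ := S.union2 A B
  obtain ⟨P, hP⟩ := S.power U
  obtain ⟨PP, hPP⟩ := S.power P
  refine ⟨PP, fun c d p hc hd ⟨s, q, hs, hq, hp⟩ => (hPP p).2 fun t ht => (hP t).2 fun w hw => ?_⟩
  rcases (hp t).1 ht with rfl | rfl
  · rw [(hs w).1 hw]; exact (hU _).2 (Or.inl hc)
  · rcases (hq w).1 hw with rfl | rfl
    · exact (hU _).2 (Or.inl hc)
    · exact (hU _).2 (Or.inr hd)

/-- comprehension for relations. -/
theorem rel (S : ZFD e₁ e₂ e) (Q : M → M → Prop)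
    (hQ : ∀ i j, Dfb e₁ e₂ (fun v => Q (v i) (v j))) (A B : M) :
    ∃ g, (∀ c d, FunVal e g c d ↔ e c A ∧ e d B ∧ Q c d) ∧
      (∀ p, e p g → ∃ a b, e a A ∧ IsOPair e a b p) := by
  obtain ⟨P, hP⟩ := S.prod A B
  obtain ⟨g, hg⟩ := S.sep (fun t A B _ _ => ∃ c d, e c A ∧ e d B ∧ Q c d ∧ IsOPair e c d t)
    (Dfb.ex (Dfb.ex ((S.dm _ _).and ((S.dm _ _).and ((hQ _ _).and (S.d_opair _ _ _)))))) P A B A A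
  refine ⟨g, fun c d => ⟨?_, ?_⟩, ?_⟩
  · rintro ⟨p, hp, hcd⟩
    obtain ⟨_, c', d', h1, h2, h3, h4⟩ := (hg p).1 hp
    obtain ⟨rfl, rfl⟩ := opair_inj hcd h4
    exact ⟨h1, h2, h3⟩
  · rintro ⟨h1, h2, h3⟩
    obtain ⟨p, hp⟩ := S.opair c d
    exact ⟨p, (hg p).2 ⟨hP c d p h1 h2 hp, c, d, h1, h2, h3, hp⟩, hp⟩
  · intro p hp
    obtain ⟨_, c', d', h1, h2, h3, h4⟩ := (hg p).1 hp
    exact ⟨c', d', h1, h4⟩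

end ZFD

section Omega

variable {M : Type u} {e₁ e₂ e : M → M → Prop}

/-- `m` is the successor of `n`. -/
def IsSuc (e : M → M → Prop) (n m : M) : Prop := ∀ t, e t m ↔ e t n ∨ t = n

/-- `m` is empty. -/
def IsEmp (e : M → M → Prop) (m : M) : Prop := ∀ t, ¬ e t m

/-- `w` is inductive. -/
def IsInd (e : M → M → Prop) (w : M) : Prop :=
  (∀ z, IsEmp e z → e z w) ∧ ∀ n, e n w → ∀ m, IsSuc e n m → e m w

/-- `v` is the union of `u`. -/
def IsUn (e : M → M → Prop) (u v : M) : Prop := ∀ t, e t v ↔ ∃ s, e s u ∧ e t s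

/-- `u` is the `n`-th iterated union of `x`. -/
def IterUn (e : M → M → Prop) (n u x : M) : Prop :=
  ∃ g, FunVal e g n u ∧ ∀ m w, FunVal e g m w →
    (IsEmp e m ∧ w = x) ∨ ∃ m' w', IsSuc e m' m ∧ FunVal e g m' w' ∧ IsUn e w' w

theorem d_suc (S : ZFD e₁ e₂ e) (i j : ℕ) : Dfb e₁ e₂ (fun v => IsSuc e (v i) (v j)) :=
  Dfb.all ((S.dm _ _).iff ((S.dm _ _).or (Dfb.eq _ _)))

theorem d_emp (S : ZFD e₁ e₂ e) (i : ℕ) : Dfb e₁ e₂ (fun v => IsEmp e (v i)) :=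
  Dfb.all (S.dm _ _).not

theorem d_ind (S : ZFD e₁ e₂ e) (i : ℕ) : Dfb e₁ e₂ (fun v => IsInd e (v i)) :=
  (Dfb.all ((d_emp S _).imp (S.dm _ _))).and
    (Dfb.all ((S.dm _ _).imp (Dfb.all ((d_suc S _ _).imp (S.dm _ _)))))

theorem d_un (S : ZFD e₁ e₂ e) (i j : ℕ) : Dfb e₁ e₂ (fun v => IsUn e (v i) (v j)) :=
  Dfb.all ((S.dm _ _).iff (Dfb.ex ((S.dm _ _).and (S.dm _ _))))

theorem d_iterUn (S : ZFD e₁ e₂ e) (i j k : ℕ) :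
    Dfb e₁ e₂ (fun v => IterUn e (v i) (v j) (v k)) :=
  Dfb.ex ((S.d_funVal _ _ _).and (Dfb.all (Dfb.all ((S.d_funVal _ _ _).imp
    (((d_emp S _).and (Dfb.eq _ _)).or
      (Dfb.ex (Dfb.ex ((d_suc S _ _).and ((S.d_funVal _ _ _).and (d_un S _ _))))))))))

theorem d_trans (S : ZFD e₁ e₂ e) (i : ℕ) : Dfb e₁ e₂ (fun v => IsTransSet e (v i)) :=
  Dfb.all ((S.dm _ _).imp (Dfb.all ((S.dm _ _).imp (S.dm _ _))))

theorem exists_omega (S : ZFD e₁ e₂ e) : ∃ w, IsInd e w ∧ ∀ w', IsInd e w' → ∀ t, e t w → e t w' := by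
  obtain ⟨W, ⟨z, hzW, hz⟩, hW⟩ := S.inf
  have hI : IsInd e W := by
    refine ⟨fun z' hz' => ?_, fun n hn m hm => ?_⟩
    · have : z' = z := S.ext _ _ fun t => ⟨fun h => (hz' t h).elim, fun h => (hz t h).elim⟩
      exact this ▸ hzW
    · obtain ⟨s, hs, hs'⟩ := hW n hn
      have : m = s := S.ext _ _ fun t => (hm t).trans (hs' t).symm
      exact this ▸ hs
  obtain ⟨w, hw⟩ := S.sep (fun t _ _ _ _ => ∀ w', IsInd e w' → e t w')
    (Dfb.all ((d_ind S _).imp (S.dm _ _))) W W W W W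
  refine ⟨w, ⟨fun z hz => (hw z).2 ⟨hI.1 z hz, fun w' hw' => hw'.1 z hz⟩, fun n hn m hm => ?_⟩, ?_⟩
  · obtain ⟨h1, h2⟩ := (hw n).1 hn
    exact (hw m).2 ⟨hI.2 n h1 m hm, fun w' hw' => hw'.2 n (h2 w' hw') m hm⟩
  · intro w' hw' t ht
    exact ((hw t).1 ht).2 w' hw'

theorem suc_inj (S : ZFD e₁ e₂ e) {n n' m : M} (h : IsSuc e n m) (h' : IsSuc e n' m) : n = n' := by
  by_contra hne
  have h1 : e n n' := ((h' n).1 ((h n).2 (Or.inr rfl))).resolve_right hne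
  have h2 : e n' n := ((h n').1 ((h' n').2 (Or.inr rfl))).resolve_right (Ne.symm hne)
  exact S.not_mem_symm _ _ h1 h2

theorem iterUn_cases {n u x : M} (h : IterUn e n u x) :
    (IsEmp e n ∧ u = x) ∨ ∃ m w, IsSuc e m n ∧ IterUn e m w x ∧ IsUn e w u := by
  obtain ⟨g, h1, h2⟩ := h
  rcases h2 _ _ h1 with h | ⟨m, w, hm, hg, hw⟩
  · exact Or.inl h
  · exact Or.inr ⟨m, w, hm, ⟨g, hg, h2⟩, hw⟩

theorem iterUn_zero (S : ZFD e₁ e₂ e) {n x : M} (h : IsEmp e n) : IterUn e n x x := by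
  obtain ⟨g, hg⟩ := S.addPair n n x
  refine ⟨g, (hg _ _).2 (Or.inr ⟨rfl, rfl⟩), fun m w hmw => ?_⟩
  rcases (hg _ _).1 hmw with ⟨p, hp, _⟩ | ⟨rfl, rfl⟩
  · exact (h p hp).elim
  · exact Or.inl ⟨h, rfl⟩

theorem iterUn_suc (S : ZFD e₁ e₂ e) {n m u w x : M} (h : IterUn e n u x) (hm : IsSuc e n m)
    (hw : IsUn e u w) : IterUn e m w x := by
  obtain ⟨g, h1, h2⟩ := h
  obtain ⟨g', hg⟩ := S.addPair g m w
  refine ⟨g', (hg _ _).2 (Or.inr ⟨rfl, rfl⟩), fun k v hkv => ?_⟩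
  rcases (hg _ _).1 hkv with h | ⟨rfl, rfl⟩
  · rcases h2 _ _ h with h | ⟨a, b, ha, hb, hc⟩
    · exact Or.inl h
    · exact Or.inr ⟨a, b, ha, (hg _ _).2 (Or.inl hb), hc⟩
  · exact Or.inr ⟨n, u, hm, (hg _ _).2 (Or.inl h1), hw⟩

theorem exists_suc (S : ZFD e₁ e₂ e) (n : M) : ∃ m, IsSuc e n m := by
  obtain ⟨s, hs⟩ := S.single n
  obtain ⟨m, hm⟩ := S.union2 n s
  exact ⟨m, fun t => by rw [hm, hs]⟩

theorem iterUn_unique (S : ZFD e₁ e₂ e) {w : M} (hw : IsInd e w)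
    (hmin : ∀ w', IsInd e w' → ∀ t, e t w → e t w') (x n : M) (hn : e n w) :
    ∀ u u', IterUn e n u x → IterUn e n u' x → u = u' := by
  obtain ⟨I, hI⟩ := S.sep (fun n x _ _ _ => ∀ u u', IterUn e n u x → IterUn e n u' x → u = u')
    (Dfb.all (Dfb.all ((d_iterUn S _ _ _).imp ((d_iterUn S _ _ _).imp (Dfb.eq _ _))))) w x x x x
  refine ((hI n).1 (hmin I ⟨fun z hz => (hI z).2 ⟨hw.1 z hz, ?_⟩,
    fun n hn m hm => (hI m).2 ⟨hw.2 n ((hI n).1 hn).1 m hm, ?_⟩⟩ n hn)).2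
  · intro u u' h h'
    rcases iterUn_cases h with ⟨_, rfl⟩ | ⟨m, _, hm, _⟩
    · rcases iterUn_cases h' with ⟨_, rfl⟩ | ⟨m, _, hm, _⟩
      · rfl
      · exact (hz m ((hm m).2 (Or.inr rfl))).elim
    · exact (hz m ((hm m).2 (Or.inr rfl))).elim
  · intro u u' h h'
    have hne : ¬ IsEmp e m := fun hz => hz n ((hm n).2 (Or.inr rfl))
    rcases iterUn_cases h with ⟨h0, _⟩ | ⟨k, a, hk, hka, hau⟩
    · exact (hne h0).elim
    rcases iterUn_cases h' with ⟨h0, _⟩ | ⟨k', a', hk', hka', hau'⟩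
    · exact (hne h0).elim
    obtain rfl := suc_inj S hk hm
    obtain rfl := suc_inj S hk' hm
    obtain rfl := ((hI _).1 hn).2 a a' hka hka'
    exact S.ext _ _ fun t => (hau t).trans (hau' t).symm

theorem exists_trans (S : ZFD e₁ e₂ e) (x : M) : ∃ T, IsTransSet e T ∧ ∀ t, e t x → e t T := by
  obtain ⟨w, hw, hmin⟩ := exists_omega S
  obtain ⟨b, hb⟩ := S.coll (fun n u x => IterUn e n u x) (fun i j k => d_iterUn S i j k) w x
    (fun n hn u u' => iterUn_unique S hw hmin x n hn u u')
  obtain ⟨b', hb'⟩ := S.sep (fun u x w _ _ => ∃ n, e n w ∧ IterUn e n u x)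
    (Dfb.ex ((S.dm _ _).and (d_iterUn S _ _ _))) b x w x x
  obtain ⟨T, hT⟩ := S.union b'
  refine ⟨T, ?_, ?_⟩
  · intro t ht r hr
    obtain ⟨u, hu, htu⟩ := (hT t).1 ht
    obtain ⟨_, n, hn, hnu⟩ := (hb' u).1 hu
    obtain ⟨m, hm⟩ := exists_suc S n
    obtain ⟨u', hu'⟩ := S.union u
    have h1 := iterUn_suc S hnu hm hu'
    have h2 := hw.2 n hn m hm
    exact (hT r).2 ⟨u', (hb' u').2 ⟨hb m h2 u' h1, m, h2, h1⟩, (hu' r).2 ⟨t, htu, hr⟩⟩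
  · intro t ht
    obtain ⟨z, hz⟩ := S.sep (fun _ _ _ _ _ => False) Dfb.fal x x x x x
    have hz : IsEmp e z := fun t => by simp [hz t]
    have h1 := iterUn_zero S (x := x) hz
    exact (hT t).2 ⟨x, (hb' x).2 ⟨hb z (hw.1 z hz) x h1, z, hw.1 z hz, h1⟩, ht⟩

theorem exists_TC (S : ZFD e₁ e₂ e) (x : M) : ∃ u, IsTC e x u := by
  obtain ⟨T, hT, hxT⟩ := exists_trans S x
  obtain ⟨u, hu⟩ := S.sep (fun t x _ _ _ => ∀ v, IsTransSet e v → (∀ w, e w x → e w v) → e t v)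
    (Dfb.all ((d_trans S _).imp ((Dfb.all ((S.dm _ _).imp (S.dm _ _))).imp (S.dm _ _)))) T x x x x
  refine ⟨u, ?_, ?_, ?_⟩
  · intro t ht w hw
    obtain ⟨h1, h2⟩ := (hu t).1 ht
    exact (hu w).2 ⟨hT t h1 w hw, fun v hv hv' => hv t (h2 v hv hv') w hw⟩
  · intro v hv
    exact (hu v).2 ⟨hxT v hv, fun v' _ h => h v hv⟩
  · intro v hv hv' w hw
    exact ((hu w).1 hw).2 v hv hv'

theorem exists_trans_mem (S : ZFD e₁ e₂ e) (x : M) : ∃ T, IsTransSet e T ∧ e x T := by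
  obtain ⟨s, hs⟩ := S.single x
  obtain ⟨T, hT, h⟩ := exists_trans S s
  exact ⟨T, hT, h x ((hs x).2 rfl)⟩

/-- `∈`-induction for definable classes. -/
theorem mem_ind (S : ZFD e₁ e₂ e) (Q : M → Prop) (hQ : Dfb e₁ e₂ (fun v => Q (v 0)))
    (h : ∀ b, (∀ c, e c b → Q c) → Q b) (b : M) : Q b := by
  by_contra hb
  obtain ⟨T, hT, hbT⟩ := exists_trans_mem S b
  obtain ⟨C, hC⟩ := S.sep (fun t _ _ _ _ => ¬ Q t) hQ.not T b b b b
  obtain ⟨c, hc, hmin⟩ := S.found C ⟨b, (hC b).2 ⟨hbT, hb⟩⟩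
  obtain ⟨h1, h2⟩ := (hC c).1 hc
  refine h2 (h c fun d hd => ?_)
  by_contra hd'
  exact hmin d hd ((hC d).2 ⟨hT c h1 d hd, hd'⟩)

end Omega

section Rank

variable {M : Type u} {e₁ e₂ e : M → M → Prop}

/-- `rank a ≤ rank b`. -/
def RLe (e : M → M → Prop) (a b : M) : Prop :=
  ∃ r, FunVal e r a b ∧ ∀ c d, FunVal e r c d → ∀ c', e c' c → ∃ d', e d' d ∧ FunVal e r c' d'

theorem d_rle (S : ZFD e₁ e₂ e) (i j : ℕ) : Dfb e₁ e₂ (fun v => RLe e (v i) (v j)) :=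
  Dfb.ex ((S.d_funVal _ _ _).and (Dfb.all (Dfb.all ((S.d_funVal _ _ _).imp
    (Dfb.all ((S.dm _ _).imp (Dfb.ex ((S.dm _ _).and (S.d_funVal _ _ _)))))))))

theorem rle_iff (S : ZFD e₁ e₂ e) (a b : M) :
    RLe e a b ↔ ∀ c, e c a → ∃ d, e d b ∧ RLe e c d := by
  constructor
  · rintro ⟨r, h1, h2⟩ c hc
    obtain ⟨d, hd, hcd⟩ := h2 a b h1 c hc
    exact ⟨d, hd, r, hcd, h2⟩
  · intro h
    obtain ⟨A, hA, haA⟩ := exists_trans_mem S a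
    obtain ⟨B, hB, hbB⟩ := exists_trans_mem S b
    obtain ⟨g, hg, _⟩ := S.rel (RLe e) (d_rle S) A B
    obtain ⟨g', hg'⟩ := S.addPair g a b
    refine ⟨g', (hg' _ _).2 (Or.inr ⟨rfl, rfl⟩), fun c d hcd c' hc' => ?_⟩
    rcases (hg' _ _).1 hcd with h1 | ⟨rfl, rfl⟩
    · obtain ⟨h1, h2, r, h3, h4⟩ := (hg _ _).1 h1
      obtain ⟨d', hd', hcd'⟩ := h4 c d h3 c' hc'
      exact ⟨d', hd', (hg' _ _).2 (Or.inl ((hg _ _).2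
        ⟨hA c h1 c' hc', hB d h2 d' hd', r, hcd', h4⟩))⟩
    · obtain ⟨d', hd', hcd'⟩ := h c' hc'
      exact ⟨d', hd', (hg' _ _).2 (Or.inl ((hg _ _).2
        ⟨hA c haA c' hc', hB d hbB d' hd', hcd'⟩))⟩

theorem rle_trans (S : ZFD e₁ e₂ e) (a : M) : ∀ b c, RLe e a b → RLe e b c → RLe e a c := by
  refine mem_ind S (fun a => ∀ b c, RLe e a b → RLe e b c → RLe e a c)
    (Dfb.all (Dfb.all ((d_rle S _ _).imp ((d_rle S _ _).imp (d_rle S _ _))))) ?_ a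
  intro a ih b c hab hbc
  refine (rle_iff S a c).2 fun a' ha' => ?_
  obtain ⟨b', hb', h1⟩ := (rle_iff S a b).1 hab a' ha'
  obtain ⟨c', hc', h2⟩ := (rle_iff S b c).1 hbc b' hb'
  exact ⟨c', hc', ih a' ha' b' c' h1 h2⟩

theorem rle_total (S : ZFD e₁ e₂ e) (a : M) : ∀ b, RLe e a b ∨ RLe e b a := by
  refine mem_ind S (fun a => ∀ b, RLe e a b ∨ RLe e b a)
    (Dfb.all ((d_rle S _ _).or (d_rle S _ _))) ?_ a
  intro a ih b
  by_cases h : RLe e a b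
  · exact Or.inl h
  · rw [rle_iff S] at h
    push Not at h
    obtain ⟨a', ha', h⟩ := h
    exact Or.inr ((rle_iff S b a).2 fun b' hb' => ⟨a', ha', (ih a' ha' b').resolve_left (h b' hb')⟩)

theorem rle_of_mem (S : ZFD e₁ e₂ e) (a : M) : ∀ b, e a b → RLe e a b := by
  refine mem_ind S (fun a => ∀ b, e a b → RLe e a b)
    (Dfb.all ((S.dm _ _).imp (d_rle S _ _))) ?_ a
  intro a ih b hab
  exact (rle_iff S a b).2 fun a' ha' => ⟨a, hab, ih a' ha' a ha'⟩

/-- The sets of rank at most `rank b` form a set. -/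
theorem rle_set (S : ZFD e₁ e₂ e) (b : M) : ∃ s, ∀ a, e a s ↔ RLe e a b := by
  refine mem_ind S (fun b => ∃ s, ∀ a, e a s ↔ RLe e a b)
    (Dfb.ex (Dfb.all ((S.dm _ _).iff (d_rle S _ _)))) ?_ b
  intro b ih
  obtain ⟨C, hC⟩ := S.coll (fun b s _ => ∀ a, e a s ↔ RLe e a b)
    (fun i j k => Dfb.all ((S.dm _ _).iff (d_rle S _ _))) b b
    (fun t _ s s' h h' => S.ext _ _ fun a => (h a).trans (h' a).symm)
  obtain ⟨U, hU⟩ := S.union C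
  obtain ⟨P, hP⟩ := S.power U
  obtain ⟨s, hs⟩ := S.sep (fun a b _ _ _ => RLe e a b) (d_rle S _ _) P b b b b
  refine ⟨s, fun a => ⟨fun h => ((hs a).1 h).2, fun h => (hs a).2 ⟨?_, h⟩⟩⟩
  refine (hP a).2 fun a' ha' => ?_
  obtain ⟨b', hb', h1⟩ := (rle_iff S a b).1 h a' ha'
  obtain ⟨s', hs'⟩ := ih b' hb'
  exact (hU a').2 ⟨s', hC b' hb' s' hs', (hs' a').2 h1⟩

end Rank

section Iso

variable {M : Type u} {e₁ e₂ e f : M → M → Prop}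

/-- Bisimilarity-like relation characterised by a fixed point equation. -/
structure IsoRel (e₁ e₂ e f : M → M → Prop) (B : M → M → Prop) : Prop where
  d : ∀ i j, Dfb e₁ e₂ (fun v => B (v i) (v j))
  fix : ∀ x y, B x y ↔
    (∀ t, e t x → ∃ s, f s y ∧ B t s) ∧ (∀ s, f s y → ∃ t, e t x ∧ B t s)

theorem IsoRel.symm {B : M → M → Prop} (H : IsoRel e₁ e₂ e f B) :
    IsoRel e₁ e₂ f e (fun x y => B y x) where
  d := fun i j => H.d j i
  fix := fun x y => (H.fix y x).trans and_comm

theorem IsoRel.fn {B : M → M → Prop} (H : IsoRel e₁ e₂ e f B) (S : ZFD e₁ e₂ e)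
    (S' : ZFD e₁ e₂ f) (x : M) : ∀ y y', B x y → B x y' → y = y' := by
  refine mem_ind S (fun x => ∀ y y', B x y → B x y' → y = y')
    (Dfb.all (Dfb.all ((H.d _ _).imp ((H.d _ _).imp (Dfb.eq _ _))))) ?_ x
  intro x ih y y' h h'
  rw [H.fix] at h h'
  refine S'.ext _ _ fun s => ⟨fun hs => ?_, fun hs => ?_⟩
  · obtain ⟨t, ht, hts⟩ := h.2 s hs
    obtain ⟨s', hs', hts'⟩ := h'.1 t ht
    exact ih t ht s s' hts hts' ▸ hs'
  · obtain ⟨t, ht, hts⟩ := h'.2 s hs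
    obtain ⟨s', hs', hts'⟩ := h.1 t ht
    exact ih t ht s s' hts hts' ▸ hs'

theorem IsoRel.rle {B : M → M → Prop} (H : IsoRel e₁ e₂ e f B) (S : ZFD e₁ e₂ e)
    (S' : ZFD e₁ e₂ f) (a : M) :
    ∀ a' b b', B a b → B a' b' → RLe e a a' → RLe f b b' := by
  refine mem_ind S (fun a => ∀ a' b b', B a b → B a' b' → RLe e a a' → RLe f b b')
    (Dfb.all (Dfb.all (Dfb.all ((H.d _ _).imp ((H.d _ _).imp
      ((d_rle S _ _).imp (d_rle S' _ _))))))) ?_ a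
  intro a ih a' b b' h h' hr
  refine (rle_iff S' b b').2 fun s hs => ?_
  obtain ⟨t, ht, hts⟩ := ((H.fix _ _).1 h).2 s hs
  obtain ⟨t', ht', htt'⟩ := (rle_iff S a a').1 hr t ht
  obtain ⟨s', hs', hts'⟩ := ((H.fix _ _).1 h').1 t' ht'
  exact ⟨s', hs', ih t ht t' s s' hts hts' htt'⟩

/-- A minimal element outside the range has preimages of unbounded rank. -/
theorem IsoRel.unbdd {B : M → M → Prop} (H : IsoRel e₁ e₂ e f B) (S : ZFD e₁ e₂ e)
    (S' : ZFD e₁ e₂ f) (h : ¬ ∀ y, ∃ x, B x y) :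
    ∃ y, ∀ x, ∃ s t, f s y ∧ B t s ∧ ¬ RLe e t x := by
  by_contra hc
  push Not at hc
  refine h (mem_ind S' (fun y => ∃ x, B x y) (Dfb.ex (H.d _ _)) ?_)
  intro y ih
  obtain ⟨x, hx⟩ := hc y
  obtain ⟨W, hW⟩ := rle_set S x
  obtain ⟨X, hX⟩ := S.sep (fun t y _ _ _ => ∃ s, f s y ∧ B t s)
    (Dfb.ex ((S'.dm _ _).and (H.d _ _))) W y y y y
  refine ⟨X, (H.fix X y).2 ⟨fun t ht => ((hX t).1 ht).2, fun s hs => ?_⟩⟩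
  obtain ⟨t, ht⟩ := ih s hs
  exact ⟨t, (hX t).2 ⟨(hW t).2 (hx s t hs ht), s, hs, ht⟩, ht⟩

theorem IsoRel.total_or {B : M → M → Prop} (H : IsoRel e₁ e₂ e f B) (S : ZFD e₁ e₂ e)
    (S' : ZFD e₁ e₂ f) : (∀ x, ∃ y, B x y) ∨ (∀ y, ∃ x, B x y) := by
  by_contra hc
  rw [not_or] at hc
  obtain ⟨y, hy⟩ := H.unbdd S S' hc.2
  obtain ⟨x, hx⟩ := H.symm.unbdd S' S hc.1
  obtain ⟨s', t', hs', hB', hn'⟩ := hy x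
  obtain ⟨t, s, ht, hB, hn⟩ := hx y
  have h1 : RLe e t x := rle_of_mem S t x ht
  have h2 : RLe f s' y := rle_of_mem S' s' y hs'
  have h3 : RLe e t t' := (rle_total S t t').resolve_right
    fun h => hn' (rle_trans S _ _ _ h h1)
  exact hn (rle_trans S' _ _ _ (H.rle S S' t t' s s' hB hB' h3) h2)

theorem IsoRel.surj_of_total {B : M → M → Prop} (H : IsoRel e₁ e₂ e f B) (S : ZFD e₁ e₂ e)
    (S' : ZFD e₁ e₂ f) (ht : ∀ x, ∃ y, B x y) : ∀ y, ∃ x, B x y := by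
  by_contra hc
  obtain ⟨y, hy⟩ := H.unbdd S S' hc
  obtain ⟨W, hW⟩ := rle_set S' y
  obtain ⟨b, hb⟩ := S'.coll (fun s t _ => B t s) (fun i j k => H.d _ _) W W
    (fun s _ t t' => H.symm.fn S' S s t t')
  obtain ⟨s, hs⟩ := ht b
  refine S'.not_mem_self b (hb s ((hW s).2 ?_) b hs)
  obtain ⟨s', t', hs', hB', hn'⟩ := hy b
  have h3 : RLe e b t' := (rle_total S b t').resolve_right hn'
  exact rle_trans S' _ _ _ (H.rle S S' b t' s s' hs hB' h3) (rle_of_mem S' s' y hs')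

theorem IsoRel.bij {B : M → M → Prop} (H : IsoRel e₁ e₂ e f B) (S : ZFD e₁ e₂ e)
    (S' : ZFD e₁ e₂ f) : (∀ x, ∃ y, B x y) ∧ (∀ y, ∃ x, B x y) := by
  rcases H.total_or S S' with h | h
  · exact ⟨h, H.surj_of_total S S' h⟩
  · exact ⟨H.symm.surj_of_total S' S h, h⟩

theorem IsoRel.mem_iff {B : M → M → Prop} (H : IsoRel e₁ e₂ e f B) (S : ZFD e₁ e₂ e)
    (S' : ZFD e₁ e₂ f) {t s x y : M} (hts : B t s) (hxy : B x y) : e t x ↔ f s y := by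
  rw [H.fix] at hxy
  constructor
  · intro h
    obtain ⟨s', hs', h'⟩ := hxy.1 t h
    exact H.fn S S' t s s' hts h' ▸ hs'
  · intro h
    obtain ⟨t', ht', h'⟩ := hxy.2 s h
    exact H.symm.fn S' S s t t' hts h' ▸ ht'

/-- The image of the transitive closure lies in the transitive closure. -/
theorem IsoRel.tc {B : M → M → Prop} (H : IsoRel e₁ e₂ e f B) (S : ZFD e₁ e₂ e)
    (S' : ZFD e₁ e₂ f) {x y u v : M} (hxy : B x y) (hu : IsTC e x u) (hv : IsTC f y v) :
    ∀ t, e t u → ∃ s, f s v ∧ B t s := by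
  obtain ⟨C, hC⟩ := S.sep (fun t v _ _ _ => ∃ s, f s v ∧ B t s)
    (Dfb.ex ((S'.dm _ _).and (H.d _ _))) u v v v v
  intro t ht
  refine ((hC t).1 (hu.2.2 C ?_ ?_ t ht)).2
  · intro a ha b hb
    obtain ⟨h1, s, hs, has⟩ := (hC a).1 ha
    obtain ⟨s', hs', h2⟩ := ((H.fix a s).1 has).1 b hb
    exact (hC b).2 ⟨hu.1 a h1 b hb, s', hv.1 s hs s' hs', h2⟩
  · intro a ha
    obtain ⟨s, hs, h2⟩ := ((H.fix x y).1 hxy).1 a ha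
    exact (hC a).2 ⟨hu.2.1 a ha, s, hv.2.1 s hs, h2⟩

/-- The bisimulation relation witnessed by `∈₁`-sets. -/
def Bis (e f : M → M → Prop) (x y : M) : Prop :=
  ∃ r, FunVal e r x y ∧ ∀ a b, FunVal e r a b →
    (∀ a', e a' a → ∃ b', f b' b ∧ FunVal e r a' b') ∧
    (∀ b', f b' b → ∃ a', e a' a ∧ FunVal e r a' b')

theorem d_bis (S : ZFD e₁ e₂ e) (S' : ZFD e₁ e₂ f) (i j : ℕ) :
    Dfb e₁ e₂ (fun v => Bis e f (v i) (v j)) :=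
  Dfb.ex ((S.d_funVal _ _ _).and (Dfb.all (Dfb.all ((S.d_funVal _ _ _).imp
    ((Dfb.all ((S.dm _ _).imp (Dfb.ex ((S'.dm _ _).and (S.d_funVal _ _ _))))).and
    (Dfb.all ((S'.dm _ _).imp (Dfb.ex ((S.dm _ _).and (S.d_funVal _ _ _))))))))))

theorem bis_unfold {x y : M} (h : Bis e f x y) :
    (∀ t, e t x → ∃ s, f s y ∧ Bis e f t s) ∧ (∀ s, f s y → ∃ t, e t x ∧ Bis e f t s) := by
  obtain ⟨r, h1, h2⟩ := h
  refine ⟨fun t ht => ?_, fun s hs => ?_⟩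
  · obtain ⟨s, hs, h3⟩ := (h2 x y h1).1 t ht
    exact ⟨s, hs, r, h3, h2⟩
  · obtain ⟨t, ht, h3⟩ := (h2 x y h1).2 s hs
    exact ⟨t, ht, r, h3, h2⟩

theorem bis_fn (S : ZFD e₁ e₂ e) (S' : ZFD e₁ e₂ f) (x : M) :
    ∀ y y', Bis e f x y → Bis e f x y' → y = y' := by
  refine mem_ind S (fun x => ∀ y y', Bis e f x y → Bis e f x y' → y = y')
    (Dfb.all (Dfb.all ((d_bis S S' _ _).imp ((d_bis S S' _ _).imp (Dfb.eq _ _))))) ?_ x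
  intro x ih y y' h h'
  have h := bis_unfold h
  have h' := bis_unfold h'
  refine S'.ext _ _ fun s => ⟨fun hs => ?_, fun hs => ?_⟩
  · obtain ⟨t, ht, hts⟩ := h.2 s hs
    obtain ⟨s', hs', hts'⟩ := h'.1 t ht
    exact ih t ht s s' hts hts' ▸ hs'
  · obtain ⟨t, ht, hts⟩ := h'.2 s hs
    obtain ⟨s', hs', hts'⟩ := h.1 t ht
    exact ih t ht s s' hts hts' ▸ hs'

/-- The restriction of `Bis` to a set is a set. -/
theorem bis_graph (S : ZFD e₁ e₂ e) (S' : ZFD e₁ e₂ f) (A : M) :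
    ∃ g, (∀ c d, FunVal e g c d ↔ e c A ∧ Bis e f c d) ∧
      (∀ p, e p g → ∃ a b, e a A ∧ IsOPair e a b p) := by
  obtain ⟨C, hC⟩ := S.coll (fun a b _ => Bis e f a b) (fun i j k => d_bis S S' _ _) A A
    (fun a _ b b' => bis_fn S S' a b b')
  obtain ⟨g, hg, hg'⟩ := S.rel (Bis e f) (d_bis S S') A C
  exact ⟨g, fun c d => ⟨fun h => ⟨((hg c d).1 h).1, ((hg c d).1 h).2.2⟩,
    fun h => (hg c d).2 ⟨h.1, hC c h.1 d h.2, h.2⟩⟩, hg'⟩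

theorem bis_iso (S : ZFD e₁ e₂ e) (S' : ZFD e₁ e₂ f) : IsoRel e₁ e₂ e f (Bis e f) where
  d := d_bis S S'
  fix := by
    intro x y
    refine ⟨bis_unfold, fun h => ?_⟩
    obtain ⟨A, hA, hxA⟩ := exists_trans_mem S x
    obtain ⟨g, hg, _⟩ := bis_graph S S' A
    obtain ⟨g', hg'⟩ := S.addPair g x y
    refine ⟨g', (hg' _ _).2 (Or.inr ⟨rfl, rfl⟩), fun a b hab => ?_⟩
    have key : e a A ∧ (∀ t, e t a → ∃ s, f s b ∧ Bis e f t s) ∧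
        (∀ s, f s b → ∃ t, e t a ∧ Bis e f t s) := by
      rcases (hg' _ _).1 hab with h1 | ⟨rfl, rfl⟩
      · exact ⟨((hg _ _).1 h1).1, bis_unfold ((hg _ _).1 h1).2⟩
      · exact ⟨hxA, h⟩
    obtain ⟨h1, h2, h3⟩ := key
    refine ⟨fun t ht => ?_, fun s hs => ?_⟩
    · obtain ⟨s, hs, hts⟩ := h2 t ht
      exact ⟨s, hs, (hg' _ _).2 (Or.inl ((hg _ _).2 ⟨hA a h1 t ht, hts⟩))⟩
    · obtain ⟨t, ht, hts⟩ := h3 s hs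
      exact ⟨t, ht, (hg' _ _).2 (Or.inl ((hg _ _).2 ⟨hA a h1 t ht, hts⟩))⟩

theorem phi_of_bis (S : ZFD e₁ e₂ e) (S' : ZFD e₁ e₂ f) {x y : M} (hxy : Bis e f x y) :
    Phi e f x y := by
  have H := bis_iso S S'
  obtain ⟨sx, hsx⟩ := S.single x
  obtain ⟨tcsx, htcsx⟩ := exists_TC S sx
  obtain ⟨tcx, htcx⟩ := exists_TC S x
  obtain ⟨tcy, htcy⟩ := exists_TC S' y
  obtain ⟨g, hg, hg'⟩ := bis_graph S S' tcsx
  have hx : e x tcsx := htcsx.2.1 x ((hsx x).2 rfl)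
  have hsub : ∀ t, e t tcx → e t tcsx :=
    htcx.2.2 tcsx htcsx.1 fun w hw => htcsx.1 x hx w hw
  refine ⟨g, sx, tcsx, tcx, tcy, hsx, htcsx, htcx, htcy, ⟨hg', ?_, ?_⟩, ?_, ?_, ?_, ?_⟩
  · intro a ha
    obtain ⟨b, hb⟩ := (H.bij S S').1 a
    exact ⟨b, (hg a b).2 ⟨ha, hb⟩⟩
  · intro a b b' h h'
    exact bis_fn S S' a b b' ((hg _ _).1 h).2 ((hg _ _).1 h').2
  · intro t ht ft hft
    obtain ⟨s, hs, hts⟩ := H.tc S S' hxy htcx htcy t ht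
    exact bis_fn S S' t s ft hts ((hg _ _).1 hft).2 ▸ hs
  · intro s hs
    obtain ⟨t, ht, hts⟩ := H.symm.tc S' S hxy htcy htcx s hs
    exact ⟨t, ht, (hg _ _).2 ⟨hsub t ht, hts⟩⟩
  · intro t ht w hw ft fw h h'
    exact H.mem_iff S S' ((hg _ _).1 h).2 ((hg _ _).1 h').2
  · exact (hg _ _).2 ⟨hx, hxy⟩

end Iso

/-- In a model of `ZFC(∈₁) ∪ ZFC(∈₂)`, the class relation defined by
`φ(x, y)` is total and surjective: `∀x ∃y φ(x, y)` and `∀y ∃x φ(x, y)`. -/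
theorem phi_total_surjective {M : Type u} (Z : ZFC2Model M) :
    (∀ x : M, ∃ y : M, Phi Z.mem1 Z.mem2 x y) ∧
    (∀ y : M, ∃ x : M, Phi Z.mem1 Z.mem2 x y) := by
  have S : ZFD Z.mem1 Z.mem2 Z.mem1 := ⟨Z.ext1, Z.found1, Z.pair1, Z.union1, Z.power1,
    Z.infinity1, Z.sep1, Z.repl1, Dfb.m1⟩
  have S' : ZFD Z.mem1 Z.mem2 Z.mem2 := ⟨Z.ext2, Z.found2, Z.pair2, Z.union2, Z.power2,
    Z.infinity2, Z.sep2, Z.repl2, Dfb.m2⟩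
  have h := (bis_iso S S').bij S S'
  refine ⟨fun x => ?_, fun y => ?_⟩
  · obtain ⟨y, hy⟩ := h.1 x
    exact ⟨y, phi_of_bis S S' hy⟩
  · obtain ⟨x, hx⟩ := h.2 y
    exact ⟨x, phi_of_bis S S' hx⟩
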